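/- (Generation theorem, uniform continuity.) Let X be a vector space over ℂ with a countable separating family of seminorms (p_j), let A : X → X be linear and strongly compatible with (p_j), and let E : ℝ → X → X be an exponential for A. Then for every j ∈ ℕ, every constant C ≥ 0 satisfying p_j(A x) ≤ C · p_j(x) for all x, every t ∈ ℝ and every x ∈ X, one has p_j(E(t)x − x) ≤ (exp(|t| · C) − 1) · p_j(x). -/

import Mathlib

open Filter

/-- Powers of an operator bounded by `C` in a seminorm are bounded by powers of `C`. -/
theorem Seminorm.map_pow_apply_le {X : Type*} [AddCommGroup X] [Module ℂ X]
    (q : Seminorm ℂ X) (A : X →ₗ[ℂ] X) {C : ℝ} (hC : 0 ≤ C)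
    (hA : ∀ x : X, q (A x) ≤ C * q x) (n : ℕ) (x : X) :
    q ((A ^ n) x) ≤ C ^ n * q x := by
  induction n with
  | zero => simp
  | succ n ih =>
    rw [pow_succ', Module.End.mul_apply]
    calc q (A ((A ^ n) x)) ≤ C * q ((A ^ n) x) := hA _
      _ ≤ C * (C ^ n * q x) := by gcongr
      _ = C ^ (n + 1) * q x := by ring

/-- The partial sums of the exponential series differ from the identity by at most
`exp (|t| * C) - 1` in a seminorm in which the operator is bounded by `C`. -/
theorem Seminorm.expSeries_partialSum_sub_le {X : Type*} [AddCommGroup X] [Module ℂ X]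
    (q : Seminorm ℂ X) (A : X →ₗ[ℂ] X) {C : ℝ} (hC : 0 ≤ C)
    (hA : ∀ x : X, q (A x) ≤ C * q x) (t : ℝ) (x : X) (N : ℕ) :
    q ((∑ n ∈ Finset.range (N + 1), ((t : ℂ) ^ n / n.factorial) • (A ^ n) x) - x)
      ≤ (Real.exp (|t| * C) - 1) * q x := by
  have hterm (n : ℕ) : q (((t : ℂ) ^ n / n.factorial) • (A ^ n) x)
      ≤ (|t| * C) ^ n / n.factorial * q x := by
    rw [map_smul_eq_mul]
    calc ‖(t : ℂ) ^ n / n.factorial‖ * q ((A ^ n) x)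
        ≤ ‖(t : ℂ) ^ n / n.factorial‖ * (C ^ n * q x) := by
          gcongr
          exact q.map_pow_apply_le A hC hA n x
      _ = (|t| * C) ^ n / n.factorial * q x := by
          simp only [norm_div, norm_pow, Complex.norm_real, Real.norm_eq_abs,
            Complex.norm_natCast]
          ring
  have hexp := Real.sum_le_exp_of_nonneg (mul_nonneg (abs_nonneg t) hC) (N + 1)
  rw [Finset.sum_range_succ'] at hexp ⊢
  simp only [pow_zero, Nat.factorial_zero, Nat.cast_one, div_one, one_smul,
    Module.End.one_apply, add_sub_cancel_right] at hexp ⊢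
  calc q (∑ n ∈ Finset.range N, ((t : ℂ) ^ (n + 1) / (n + 1).factorial) • (A ^ (n + 1)) x)
      ≤ ∑ n ∈ Finset.range N,
          q (((t : ℂ) ^ (n + 1) / (n + 1).factorial) • (A ^ (n + 1)) x) :=
        Finset.le_sum_of_subadditive q (map_zero q).le (map_add_le_add q) _ _
    _ ≤ ∑ n ∈ Finset.range N, (|t| * C) ^ (n + 1) / (n + 1).factorial * q x :=
        Finset.sum_le_sum fun n _ => hterm (n + 1)
    _ = (∑ n ∈ Finset.range N, (|t| * C) ^ (n + 1) / (n + 1).factorial) * q x := by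
        rw [Finset.sum_mul]
    _ ≤ (Real.exp (|t| * C) - 1) * q x := by
        gcongr
        linarith

/-- Generation theorem, uniform continuity: if `E` is an exponential for a
strongly compatible linear map `A`, then for every `j`, every `C ≥ 0` with
`p j (A x) ≤ C * p j x` for all `x`, every `t` and every `x`,
`p j (E t x - x) ≤ (exp (|t| * C) - 1) * p j x`. -/
theorem stmt_4 {X : Type*} [AddCommGroup X] [Module ℂ X]
    (p : ℕ → Seminorm ℂ X)
    (hsep : ∀ x : X, (∀ j : ℕ, p j x = 0) → x = 0)
    (A : X →ₗ[ℂ] X)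
    (hA : ∀ j : ℕ, ∃ C : ℝ, 0 ≤ C ∧ ∀ x : X, p j (A x) ≤ C * p j x)
    (E : ℝ → X → X)
    (hE : ∀ (t : ℝ) (x : X) (j : ℕ),
      Tendsto (fun N : ℕ =>
          p j ((∑ n ∈ Finset.range N, ((t : ℂ) ^ n / n.factorial) • (A ^ n) x) - E t x))
        atTop (nhds 0)) :
    ∀ (j : ℕ) (C : ℝ), 0 ≤ C → (∀ x : X, p j (A x) ≤ C * p j x) →
      ∀ (t : ℝ) (x : X), p j (E t x - x) ≤ (Real.exp (|t| * C) - 1) * p j x := by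
  intro j C hC hAC t x
  have hlim := ((tendsto_add_atTop_iff_nat 1).2 (hE t x j)).add_const
    ((Real.exp (|t| * C) - 1) * p j x)
  rw [zero_add] at hlim
  refine ge_of_tendsto' hlim fun N => ?_
  set S := ∑ n ∈ Finset.range (N + 1), ((t : ℂ) ^ n / n.factorial) • (A ^ n) x
  calc p j (E t x - x) = p j ((E t x - S) + (S - x)) := by rw [sub_add_sub_cancel]
    _ ≤ p j (E t x - S) + p j (S - x) := map_add_le_add _ _ _
    _ ≤ p j (S - E t x) + (Real.exp (|t| * C) - 1) * p j x := by
        rw [map_sub_rev]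
        gcongr
        exact (p j).expSeries_partialSum_sub_le A hC hAC t x N
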